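/- For every integer N ≥ 1, the following identity of rational numbers holds: ∑_{d ∣ N} d · k_d = N · ∑_{j=0}^{⌊N/2⌋} binom(N−j, j) / (N−j), where the left-hand sum is over the positive divisors d of N. -/

import Mathlib

/-- A word over a totally ordered alphabet is Lyndon if it is nonempty and
lexicographically strictly smaller than each of its proper nonempty suffixes. -/
def IsLyndon {α : Type*} [LinearOrder α] (w : List α) : Prop :=
  w ≠ [] ∧ ∀ s : List α, s <:+ w → s ≠ [] → s ≠ w → List.Lex (· < ·) w s

/-- `kly n` is the number of Lyndon words over the alphabet `{1, 2}` of weight `n`. -/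
noncomputable def kly (n : ℕ) : ℕ :=
  Nat.card {w : List ℕ // (∀ a ∈ w, a = 1 ∨ a = 2) ∧ w.sum = n ∧ IsLyndon w}


namespace LyndonAux

/-- `m`-fold concatenation power of a word. -/
def pw {α : Type*} (u : List α) : ℕ → List α
  | 0 => []
  | m + 1 => u ++ pw u m

theorem pw_length {α : Type*} (u : List α) (m : ℕ) : (pw u m).length = m * u.length := by
  induction m with
  | zero => simp [pw]
  | succ m ih => simp [pw, ih]; ring

theorem pw_sum (u : List ℕ) (m : ℕ) : (pw u m).sum = m * u.sum := by
  induction m with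
  | zero => simp [pw]
  | succ m ih => simp [pw, ih]; ring

theorem mem_pw {α : Type*} (u : List α) (m : ℕ) {a : α} (h : a ∈ pw u m) : a ∈ u := by
  induction m with
  | zero => simp [pw] at h
  | succ m ih =>
    simp only [pw, List.mem_append] at h
    exact h.elim id ih

theorem mem_pw_of {α : Type*} (u : List α) (m : ℕ) (hm : 0 < m) {a : α} (h : a ∈ u) :
    a ∈ pw u m := by
  cases m with
  | zero => omega
  | succ m => simp [pw, h]

theorem pw_cons_append {α : Type*} (a : α) (t : List α) (m : ℕ) :
    pw (a :: t) m ++ [a] = a :: pw (t ++ [a]) m := by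
  induction m with
  | zero => simp [pw]
  | succ m ih => simp [pw, ih]

theorem pw_rotate_one {α : Type*} (u : List α) (m : ℕ) :
    (pw u m).rotate 1 = pw (u.rotate 1) m := by
  cases u with
  | nil =>
    have : ∀ m, pw ([] : List α) m = [] := by
      intro m
      induction m with
      | zero => rfl
      | succ m ih => simp [pw, ih]
    simp [this]
  | cons a t =>
    cases m with
    | zero => simp [pw]
    | succ m =>
      simp only [pw, List.cons_append, List.rotate_cons_succ, List.rotate_zero]
      rw [List.append_assoc, pw_cons_append]
      simp

theorem pw_rotate {α : Type*} (u : List α) (m r : ℕ) :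
    (pw u m).rotate r = pw (u.rotate r) m := by
  induction r with
  | zero => simp
  | succ r ih => rw [← List.rotate_rotate, ih, pw_rotate_one, List.rotate_rotate]

theorem pw_inj {α : Type*} {u v : List α} {m : ℕ} (hm : 0 < m) (hl : u.length = v.length)
    (h : pw u m = pw v m) : u = v := by
  cases m with
  | zero => omega
  | succ m => exact (List.append_inj h hl).1

theorem lt_split {a b : List ℕ} (h : List.Lex (· < ·) a b) :
    (∃ t, b = a ++ t) ∨ ∀ x y, List.Lex (· < ·) (a ++ x) (b ++ y) := by
  induction h with
  | nil => left; exact ⟨_, rfl⟩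
  | rel h => right; intro x y; exact List.Lex.rel h
  | cons h ih =>
    rcases ih with ⟨t, rfl⟩ | ih
    · left; exact ⟨t, rfl⟩
    · right; intro x y; exact List.Lex.cons (ih x y)

theorem lt_append {a b : List ℕ} (hl : a.length = b.length) (h : a < b) (x y : List ℕ) :
    a ++ x < b ++ y := by
  rcases lt_split h with ⟨t, rfl⟩ | h
  · have : t = [] := by
      apply List.eq_nil_of_length_eq_zero
      simp at hl; simp [hl]
    subst this
    simp at h
  · exact h x y

theorem pw_lt {u v : List ℕ} {m : ℕ} (hm : 0 < m) (hl : u.length = v.length)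
    (h : u < v) : pw u m < pw v m := by
  cases m with
  | zero => omega
  | succ m => exact lt_append hl h _ _

theorem append_lt_cancel (s : List ℕ) {t p : List ℕ} (h : s ++ t < s ++ p) : t < p := by
  induction s with
  | nil => simpa using h
  | cons a s ih => 
    apply ih
    simpa [List.cons_lt_cons_iff] using h

theorem lyndon_lt_rotate {w : List ℕ} (h : IsLyndon w) {i : ℕ} (h0 : 0 < i) (hi : i < w.length) :
    w < w.rotate i := by
  rw [List.rotate_eq_drop_append_take hi.le]
  have h1 := h.2 (w.drop i) (List.drop_suffix i w) (by simp; omega)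
    (by intro e; have := congrArg List.length e; simp at this; omega)
  exact List.Lex.append_right _ _ h1

theorem lyndon_of_rotate {w : List ℕ} (hw : w ≠ [])
    (h : ∀ i, 0 < i → i < w.length → w < w.rotate i) : IsLyndon w := by
  refine ⟨hw, ?_⟩
  rintro s ⟨p, rfl⟩ hs hne
  have hp : p ≠ [] := by rintro rfl; simp at hne
  have hpl := List.length_pos_iff.2 hp
  have hsl := List.length_pos_iff.2 hs
  have h1 := h p.length hpl (by simp; omega)
  rw [List.rotate_append_length_eq] at h1
  rcases lt_trichotomy (p ++ s) s with h2 | h2 | h2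
  · exact h2
  · exact absurd h2.symm hne
  · exfalso
    rcases lt_split h2 with ⟨t, ht⟩ | h3
    · have h4 := h s.length hsl (by simp; omega)
      have htl : t.length = p.length := by
        have := congrArg List.length ht
        simp at this; omega
      rw [ht] at h1
      have h5 := lt_append htl (append_lt_cancel s h1) s s
      rw [ht, List.rotate_append_length_eq, ← ht] at h4
      exact lt_asymm h4 h5
    · have := h3 p []
      rw [List.append_nil] at this
      exact lt_asymm h1 this

theorem pw_min {u : List ℕ} (hu : IsLyndon u) {m : ℕ} (hm : 0 < m) (r : ℕ) :
    pw u m ≤ (pw u m).rotate r := by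
  have hl : 0 < u.length := List.length_pos_iff.2 hu.1
  rw [pw_rotate, ← List.rotate_mod]
  rcases Nat.eq_zero_or_pos (r % u.length) with h | h
  · rw [h]; simp
  · exact (pw_lt hm (by simp) (lyndon_lt_rotate hu h (Nat.mod_lt _ hl))).le

theorem pw_length_le {u v : List ℕ} (hu : IsLyndon u) (hv : IsLyndon v) {m n : ℕ}
    (hn : 0 < n) (h : pw u m = pw v n) : v.length ≤ u.length := by
  by_contra hlt
  push Not at hlt
  have h1 : pw (v.rotate u.length) n = pw v n := by
    rw [← pw_rotate, ← h, pw_rotate, List.rotate_length]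
  have h2 := pw_inj hn (by simp) h1
  have := lyndon_lt_rotate hv (List.length_pos_iff.2 hu.1) hlt
  rw [h2] at this
  exact lt_irrefl _ this

theorem pw_unique {u v : List ℕ} (hu : IsLyndon u) (hv : IsLyndon v) {m n : ℕ}
    (hm : 0 < m) (hn : 0 < n) (h : pw u m = pw v n) : u = v := by
  have hl := le_antisymm (pw_length_le hv hu hm h.symm) (pw_length_le hu hv hn h)
  cases m with
  | zero => omega
  | succ m =>
    cases n with
    | zero => omega
    | succ n => exact (List.append_inj h hl).1

theorem rot_inj {u : List ℕ} (hu : IsLyndon u) {r s : ℕ} (hs : s < u.length)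
    (h : u.rotate r = u.rotate s) : ¬ r < s := by
  intro hrs
  have h1 : u.rotate r = (u.rotate (s - r)).rotate r := by
    rw [List.rotate_rotate, h]; congr 1; omega
  have h2 := List.rotate_injective r h1
  have := lyndon_lt_rotate hu (i := s - r) (by omega) (by omega)
  rw [← h2] at this
  exact lt_irrefl _ this

theorem unique {u v : List ℕ} (hu : IsLyndon u) (hv : IsLyndon v) {m n r s : ℕ}
    (hm : 0 < m) (hn : 0 < n) (hr : r < u.length) (hs : s < v.length)
    (hl : (pw u m).rotate r = (pw v n).rotate s) (hlen : u = v → m = n) : u = v ∧ r = s := by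
  have h1 : pw u m ~r pw v n :=
    (List.IsRotated.trans ⟨r, rfl⟩ (hl ▸ List.IsRotated.symm ⟨s, rfl⟩))
  have h2 : pw u m = pw v n := by
    apply le_antisymm
    · obtain ⟨k, hk⟩ := h1
      rw [← hk]; exact pw_min hu hm k
    · obtain ⟨k, hk⟩ := h1.symm
      rw [← hk]; exact pw_min hv hn k
  have h3 := pw_unique hu hv hm hn h2
  refine ⟨h3, ?_⟩
  have h4 := hlen h3
  subst h3
  subst h4
  rw [pw_rotate, pw_rotate] at hl
  have h5 := pw_inj hm (by simp) hl
  exact le_antisymm (not_lt.1 (rot_inj hu hr h5.symm)) (not_lt.1 (rot_inj hu hs h5))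

theorem pw_of_comm {α : Type*} (u : List α) (k : ℕ) : ∀ x : List α, x ++ u = u ++ x →
    x.length = k * u.length → x = pw u k := by
  induction k with
  | zero => intro x _ h; simpa [pw] using h
  | succ k ih =>
    intro x hx hl
    have hp : u <+: x := by
      apply List.prefix_of_prefix_length_le (l₃ := x ++ u)
      · rw [hx]; exact List.prefix_append _ _
      · exact List.prefix_append _ _
      · rw [hl]; nlinarith
    obtain ⟨x', rfl⟩ := hp
    simp only [pw]
    rw [← ih x' (by simpa using hx) (by simp at hl; linarith)]

theorem exists_pw (w : List ℕ) (hw : w ≠ []) : ∃ u m r, IsLyndon u ∧ 0 < m ∧ r < u.length ∧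
    w = (pw u m).rotate r := by
  have hwl := List.length_pos_iff.2 hw
  obtain ⟨i, hi, hmin⟩ := Finset.exists_min_image (Finset.range w.length) (fun i => w.rotate i)
    ⟨0, by simpa using hwl⟩
  set x := w.rotate i with hx
  have hxl : x.length = w.length := by simp [hx]
  have hmin' : ∀ j, x ≤ x.rotate j := by
    intro j
    rw [hx, List.rotate_rotate, ← List.rotate_mod w (i + j)]
    exact hmin _ (by simpa using Nat.mod_lt _ hwl)
  have hiter : ∀ n, (fun l : List ℕ => l.rotate 1)^[n] x = x.rotate n := by
    intro n
    induction n with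
    | zero => simp
    | succ n ih => rw [Function.iterate_succ_apply', ih, List.rotate_rotate]
  set p := Function.minimalPeriod (fun l : List ℕ => l.rotate 1) x with hp
  have hper : Function.IsPeriodicPt (fun l : List ℕ => l.rotate 1) x.length x := by
    unfold Function.IsPeriodicPt Function.IsFixedPt
    rw [hiter, List.rotate_length]
  have hdvd : p ∣ x.length := hper.minimalPeriod_dvd
  have hppos : 0 < p := hper.minimalPeriod_pos (by omega)
  have hrot : x.rotate p = x := by
    rw [← hiter]; exact Function.iterate_minimalPeriod
  have hne : ∀ j, 0 < j → j < p → x.rotate j ≠ x := by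
    intro j h0 hj h
    have : Function.IsPeriodicPt (fun l : List ℕ => l.rotate 1) j x := by
      unfold Function.IsPeriodicPt Function.IsFixedPt
      rw [hiter, h]
    exact absurd (this.minimalPeriod_le h0) (by omega)
  obtain ⟨m, hm⟩ := hdvd
  have hm0 : 0 < m := by
    rcases Nat.eq_zero_or_pos m with h | h
    · subst h; omega
    · exact h
  have hple : p ≤ x.length := by rw [hm]; nlinarith
  set u := x.take p with hu
  have hul : u.length = p := by simp [hu, hple]
  have hxu : x = pw u m := by
    apply pw_of_comm
    · have h1 : x = u ++ x.drop p := by simp [hu]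
      have h2 : x = x.drop p ++ u := by
        rw [List.rotate_eq_drop_append_take hple] at hrot
        exact hrot.symm
      conv_lhs => rw [h1]
      rw [List.append_assoc, ← h2]
    · rw [hul, hm]; ring
  have hlyn : IsLyndon u := by
    apply lyndon_of_rotate
    · rw [← List.length_pos_iff]; omega
    · intro j h0 hj
      rcases lt_trichotomy u (u.rotate j) with h | h | h
      · exact h
      · exfalso
        apply hne j h0 (by omega)
        rw [hxu, pw_rotate, ← h]
      · exfalso
        have h1 := pw_lt hm0 (by simp) h
        rw [← pw_rotate, ← hxu] at h1
        exact absurd (hmin' j) (not_le.2 h1)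
  have hback : w = x.rotate (w.length - i) := by
    rw [hx, List.rotate_rotate]
    have : i < w.length := by simpa using hi
    rw [show i + (w.length - i) = w.length by omega, List.rotate_length]
  refine ⟨u, m, (w.length - i) % u.length, hlyn, hm0, Nat.mod_lt _ (by omega), ?_⟩
  rw [pw_rotate, List.rotate_mod, ← pw_rotate, ← hxu]
  exact hback

/-- words over `{1,2}` of length `l` with `j` letters equal to `2`. -/
def V : ℕ → ℕ → Finset (List ℕ)
  | 0, 0 => {[]}
  | 0, _ + 1 => ∅
  | l + 1, 0 => (V l 0).image (List.cons 1)
  | l + 1, j + 1 => (V l (j + 1)).image (List.cons 1) ∪ (V l j).image (List.cons 2)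

theorem card_V (l : ℕ) : ∀ j, (V l j).card = l.choose j := by
  induction l with
  | zero => intro j; cases j <;> simp [V]
  | succ l ih =>
    intro j
    cases j with
    | zero =>
      rw [V, Finset.card_image_of_injective _ List.cons_injective, ih]; simp
    | succ j =>
      rw [V, Finset.card_union_of_disjoint, Finset.card_image_of_injective _ List.cons_injective,
        Finset.card_image_of_injective _ List.cons_injective, ih, ih, Nat.choose_succ_succ, add_comm]
      rw [Finset.disjoint_left]
      intro a ha hb
      simp only [Finset.mem_image] at ha hb
      obtain ⟨x, _, rfl⟩ := ha
      obtain ⟨y, _, h⟩ := hb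
      simp at h

theorem len_le_sum (w : List ℕ) (h : ∀ a ∈ w, a = 1 ∨ a = 2) :
    w.length ≤ w.sum ∧ w.sum ≤ 2 * w.length := by
  induction w with
  | nil => simp
  | cons a t ih =>
    have := ih (fun b hb => h b (by simp [hb]))
    have := h a (by simp)
    simp
    omega

theorem mem_V (l : ℕ) : ∀ j w, w ∈ V l j ↔
    (∀ a ∈ w, a = 1 ∨ a = 2) ∧ w.length = l ∧ w.sum = l + j := by
  induction l with
  | zero =>
    intro j w
    cases j with
    | zero => 
      simp only [V, Finset.mem_singleton]
      constructor
      · rintro rfl; simp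
      · rintro ⟨_, h, _⟩; simpa using h
    | succ j =>
      simp only [V, Finset.notMem_empty, false_iff]
      rintro ⟨_, h, h2⟩
      rw [List.length_eq_zero_iff] at h
      subst h
      simp at h2
  | succ l ih =>
    intro j w
    cases w with
    | nil => cases j <;> simp [V]
    | cons a t =>
      have hb := len_le_sum t
      cases j with
      | zero =>
        simp only [V, Finset.mem_image, ih, List.cons.injEq, List.mem_cons, forall_eq_or_imp,
          List.length_cons, List.sum_cons]
        constructor
        · rintro ⟨x, ⟨h1, h2, h3⟩, rfl, rfl⟩
          exact ⟨⟨Or.inl rfl, h1⟩, by omega, by omega⟩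
        · rintro ⟨⟨h0, h1⟩, h2, h3⟩
          have := hb h1
          exact ⟨t, ⟨h1, by omega, by omega⟩, by omega, rfl⟩
      | succ j =>
        simp only [V, Finset.mem_union, Finset.mem_image, ih, List.cons.injEq, List.mem_cons,
          forall_eq_or_imp, List.length_cons, List.sum_cons]
        constructor
        · rintro (⟨x, ⟨h1, h2, h3⟩, rfl, rfl⟩ | ⟨x, ⟨h1, h2, h3⟩, rfl, rfl⟩)
          · exact ⟨⟨Or.inl rfl, h1⟩, by omega, by omega⟩
          · exact ⟨⟨Or.inr rfl, h1⟩, by omega, by omega⟩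
        · rintro ⟨⟨rfl | rfl, h1⟩, h2, h3⟩
          · left; exact ⟨t, ⟨h1, by omega, by omega⟩, rfl, rfl⟩
          · right; exact ⟨t, ⟨h1, by omega, by omega⟩, rfl, rfl⟩

/-- words over `{1,2}` of weight `N`. -/
def W (N : ℕ) : Finset (List ℕ) := (Finset.Icc 0 (N / 2)).biUnion fun j => V (N - j) j

theorem mem_W (N : ℕ) (w : List ℕ) : w ∈ W N ↔ (∀ a ∈ w, a = 1 ∨ a = 2) ∧ w.sum = N := by
  simp only [W, Finset.mem_biUnion, Finset.mem_Icc, mem_V]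
  constructor
  · rintro ⟨j, hj, h1, h2, h3⟩
    exact ⟨h1, by omega⟩
  · rintro ⟨h1, h2⟩
    have := len_le_sum w h1
    exact ⟨N - w.length, by omega, h1, by omega, by omega⟩

theorem sum_W (N : ℕ) : ∑ w ∈ W N, (1 : ℚ) / (w.length : ℚ) =
    ∑ j ∈ Finset.Icc 0 (N / 2), (Nat.choose (N - j) j : ℚ) / ((N - j : ℕ) : ℚ) := by
  rw [W, Finset.sum_biUnion]
  · apply Finset.sum_congr rfl
    intro j hj
    rw [Finset.sum_congr rfl (g := fun _ => (1 : ℚ) / ((N - j : ℕ) : ℚ))]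
    · rw [Finset.sum_const, card_V, nsmul_eq_mul]; ring
    · intro w hw
      rw [mem_V] at hw
      rw [hw.2.1]
  · intro i hi j hj hij
    simp only [Finset.coe_Icc, Set.mem_Icc] at hi hj
    change Disjoint (V (N - i) i) (V (N - j) j)
    rw [Finset.disjoint_left]
    intro w h1 h2
    rw [mem_V] at h1 h2
    omega

open Classical in
theorem kly_eq (d : ℕ) : kly d = ((W d).filter IsLyndon).card := by
  unfold kly
  apply Nat.subtype_card
  intro w
  simp only [Finset.mem_filter, mem_W, and_assoc]

open Classical in
theorem main_sum (N : ℕ) (hN : 1 ≤ N) :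
    ∑ d ∈ N.divisors, (d : ℚ) * (kly d : ℚ) = ∑ w ∈ W N, (N : ℚ) * (1 / (w.length : ℚ)) := by
  have h1 : ∀ d ∈ N.divisors, (d : ℚ) * (kly d : ℚ) =
      ∑ u ∈ (W d).filter IsLyndon, ∑ _r ∈ Finset.range u.length, (d : ℚ) / (u.length : ℚ) := by
    intro d _
    rw [kly_eq, mul_comm, ← nsmul_eq_mul, ← Finset.sum_const]
    apply Finset.sum_congr rfl
    intro u hu
    have hu' := (Finset.mem_filter.1 hu).2
    have : (u.length : ℚ) ≠ 0 := by
      have := List.length_pos_iff.2 hu'.1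
      positivity
    rw [Finset.sum_const, Finset.card_range, nsmul_eq_mul]
    field_simp
  rw [Finset.sum_congr rfl h1, Finset.sum_sigma', Finset.sum_sigma']
  refine Finset.sum_bij (fun x _ => (pw x.1.2 (N / x.1.1)).rotate x.2) ?_ ?_ ?_ ?_
  · rintro ⟨⟨d, u⟩, r⟩ h
    simp only [Finset.mem_sigma, Nat.mem_divisors, Finset.mem_filter, mem_W,
      Finset.mem_range] at h
    obtain ⟨⟨⟨hd, _⟩, ⟨h12, hs⟩, hl⟩, hr⟩ := h
    rw [mem_W]
    refine ⟨fun a ha => h12 a (mem_pw u _ (List.mem_rotate.1 ha)), ?_⟩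
    rw [(List.rotate_perm _ _).sum_eq, pw_sum, hs]
    exact Nat.div_mul_cancel hd
  · rintro ⟨⟨d, u⟩, r⟩ h ⟨⟨e, v⟩, s⟩ h' heq
    simp only [Finset.mem_sigma, Nat.mem_divisors, Finset.mem_filter, mem_W,
      Finset.mem_range] at h h' heq
    obtain ⟨⟨⟨hd, _⟩, ⟨h12, hs⟩, hl⟩, hr⟩ := h
    obtain ⟨⟨⟨hd', _⟩, ⟨h12', hs'⟩, hl'⟩, hr'⟩ := h'
    obtain ⟨rfl, rfl⟩ := unique hl hl' (Nat.div_pos (Nat.le_of_dvd hN hd) (Nat.pos_of_dvd_of_pos hd hN))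
      (Nat.div_pos (Nat.le_of_dvd hN hd') (Nat.pos_of_dvd_of_pos hd' hN)) hr hr' heq
      (by rintro rfl; rw [← hs, ← hs'])
    obtain rfl : d = e := by rw [← hs, ← hs']
    rfl
  · intro w hw
    rw [mem_W] at hw
    obtain ⟨h12, hs⟩ := hw
    obtain ⟨u, m, r, hu, hm, hr, rfl⟩ := exists_pw w (by rintro rfl; simp at hs; omega)
    rw [(List.rotate_perm _ _).sum_eq, pw_sum] at hs
    have hpos : 0 < u.sum := by
      rcases Nat.eq_zero_or_pos u.sum with h | h
      · rw [h] at hs; omega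
      · exact h
    refine ⟨⟨⟨u.sum, u⟩, r⟩, ?_, ?_⟩
    · simp only [Finset.mem_sigma, Nat.mem_divisors, Finset.mem_filter, mem_W,
        Finset.mem_range]
      exact ⟨⟨⟨⟨m, by rw [← hs]; ring⟩, by omega⟩,
        ⟨fun a ha => h12 a (List.mem_rotate.2 (mem_pw_of u m hm ha)), trivial⟩, hu⟩, hr⟩
    · simp only
      rw [← hs, Nat.mul_div_cancel _ hpos]
  · rintro ⟨⟨d, u⟩, r⟩ h
    simp only [Finset.mem_sigma, Nat.mem_divisors, Finset.mem_filter, mem_W,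
      Finset.mem_range] at h
    obtain ⟨⟨⟨⟨m, rfl⟩, _⟩, ⟨h12, hs⟩, hl⟩, hr⟩ := h
    have hd0 : 0 < d := Nat.pos_of_mul_pos_right hN
    have hm0 : 0 < m := Nat.pos_of_mul_pos_left hN
    simp only [List.length_rotate, pw_length, Nat.mul_div_cancel_left _ hd0]
    have : (u.length : ℚ) ≠ 0 := by
      have := List.length_pos_iff.2 hl.1
      positivity
    have : (m : ℚ) ≠ 0 := by positivity
    push_cast
    field_simp

end LyndonAux

/-- For every `N ≥ 1`:
`∑_{d ∣ N} d k_d = N ∑_{j=0}^{⌊N/2⌋} C(N−j, j)/(N−j)` as rational numbers. -/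
theorem statement11 (N : ℕ) (hN : 1 ≤ N) :
    ∑ d ∈ N.divisors, (d : ℚ) * (kly d : ℚ) =
      (N : ℚ) * ∑ j ∈ Finset.Icc 0 (N / 2), (Nat.choose (N - j) j : ℚ) / ((N - j : ℕ) : ℚ) := by
  rw [LyndonAux.main_sum N hN, ← LyndonAux.sum_W, Finset.mul_sum]
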